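/- Let G be a finite group and let V₁, …, V_ℓ be irreducible finite-dimensional complex representations of G with Frobenius–Schur indicators ν_i := |G|⁻¹ ∑_{g∈G} χ_{V_i}(g²) ∈ {0, +1, −1}. Suppose there exists a permutation π of {1, …, ℓ} such that V_{π(i)} is isomorphic to the dual representation V_i* for every i. Set ν := ∏_{i=1}^ℓ (1 + ν_i − ν_i²). Then the space of G-invariants H := (V₁ ⊗ V₂ ⊗ ⋯ ⊗ V_ℓ)^G carries a non-degenerate bilinear form which is symmetric if ν = +1 and antisymmetric if ν = −1; in particular, if ν = −1 then H is even-dimensional. -/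

import Mathlib

open scoped TensorProduct

noncomputable section

/-- The Frobenius–Schur indicator of a representation of a finite group `G`:
`ν(V) = |G|⁻¹ ∑_{g ∈ G} χ_V(g²)`. -/
def fsIndicator (G : Type*) [Group G] [Fintype G] {W : Type*} [AddCommGroup W] [Module ℂ W]
    (ρ : Representation ℂ G W) : ℂ :=
  (Fintype.card G : ℂ)⁻¹ * ∑ g : G, LinearMap.trace ℂ W (ρ (g * g))

/-- A representation is irreducible if the space is nonzero and the only subspaces stable
under all `ρ g` are `⊥` and `⊤`. -/
def RepIsIrreducible {G W : Type*} [Group G] [AddCommGroup W] [Module ℂ W]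
    (ρ : Representation ℂ G W) : Prop :=
  Nontrivial W ∧ ∀ p : Submodule ℂ W, (∀ g : G, ∀ x ∈ p, ρ g x ∈ p) → p = ⊥ ∨ p = ⊤

/-- The diagonal action of `G` on the tensor product `V₁ ⊗ V₂ ⊗ ⋯ ⊗ V_ℓ`. -/
def piTensorRep {ℓ : ℕ} {G : Type*} [Group G] {V : Fin ℓ → Type*}
    [∀ i, AddCommGroup (V i)] [∀ i, Module ℂ (V i)]
    (ρ : ∀ i, Representation ℂ G (V i)) : Representation ℂ G (⨂[ℂ] i, V i) :=
  PiTensorProduct.mapMonoidHom.comp (Pi.monoidHom ρ)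

section Auxiliary

open Module

/-- A linear map `V → W*` is an invariant pairing if the associated bilinear form on `V × W` is
invariant under the diagonal action of `G`. -/
def IsInvariantPairing {G V W : Type*} [Group G] [AddCommGroup V] [Module ℂ V]
    [AddCommGroup W] [Module ℂ W] (ρ : Representation ℂ G V) (τ : Representation ℂ G W)
    (B : V →ₗ[ℂ] Dual ℂ W) : Prop :=
  ∀ g x y, B (ρ g x) (τ g y) = B x y

/-- Two representations are dually paired if `V` is isomorphic to the dual of `W`. -/
def IsDuallyPaired {G V W : Type*} [Group G] [AddCommGroup V] [Module ℂ V]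
    [AddCommGroup W] [Module ℂ W] (ρ : Representation ℂ G V) (τ : Representation ℂ G W) : Prop :=
  ∃ e : V ≃ₗ[ℂ] Dual ℂ W, IsInvariantPairing ρ τ e.toLinearMap

section Pairing

variable {G V W : Type*} [Group G] [AddCommGroup V] [Module ℂ V] [AddCommGroup W] [Module ℂ W]
  {ρ : Representation ℂ G V} {τ : Representation ℂ G W}

theorem IsInvariantPairing.flip {B : V →ₗ[ℂ] Dual ℂ W} (hB : IsInvariantPairing ρ τ B) :
    IsInvariantPairing τ ρ B.flip :=
  fun g x y => hB g y x

theorem IsInvariantPairing.apply_left {B : V →ₗ[ℂ] Dual ℂ W} (hB : IsInvariantPairing ρ τ B)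
    (g : G) (x : V) (y : W) : B (ρ g x) y = B x (τ g⁻¹ y) := by
  rw [← hB g x (τ g⁻¹ y), Representation.self_inv_apply]

theorem flip_bijective [FiniteDimensional ℂ V] [FiniteDimensional ℂ W] {B : V →ₗ[ℂ] Dual ℂ W}
    (hB : Function.Bijective B) : Function.Bijective B.flip :=
  ((evalEquiv ℂ W).trans (LinearEquiv.ofBijective B hB).dualMap).bijective

theorem IsDuallyPaired.symm [FiniteDimensional ℂ V] [FiniteDimensional ℂ W]
    (h : IsDuallyPaired ρ τ) : IsDuallyPaired τ ρ := by
  obtain ⟨e, he⟩ := h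
  exact ⟨LinearEquiv.ofBijective e.toLinearMap.flip (flip_bijective e.bijective), he.flip⟩

theorem IsDuallyPaired.trans_trans {V' W' : Type*} [AddCommGroup V'] [Module ℂ V']
    [AddCommGroup W'] [Module ℂ W'] {ρ' : Representation ℂ G V'} {τ' : Representation ℂ G W'}
    [FiniteDimensional ℂ V'] [FiniteDimensional ℂ W]
    (h₁ : IsDuallyPaired ρ τ) (h₂ : IsDuallyPaired τ ρ') (h₃ : IsDuallyPaired ρ' τ') :
    IsDuallyPaired ρ τ' := by
  obtain ⟨e₁, he₁⟩ := h₁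
  obtain ⟨e₂, he₂⟩ := h₂.symm
  obtain ⟨e₃, he₃⟩ := h₃
  refine ⟨e₁.trans (e₂.symm.trans e₃), fun g x y => ?_⟩
  have key : e₂.symm (e₁ (ρ g x)) = ρ' g (e₂.symm (e₁ x)) := by
    apply e₂.injective
    ext y
    have h1 := he₁.apply_left g x y
    have h2 := he₂.apply_left g (e₂.symm (e₁ x)) y
    simp only [LinearEquiv.coe_coe, LinearEquiv.apply_symm_apply] at h1 h2 ⊢
    rw [h1, h2]
  have h3 := he₃ g (e₂.symm (e₁ x)) y
  simp only [LinearEquiv.coe_coe, LinearEquiv.trans_apply] at h3 ⊢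
  rw [key, h3]

theorem IsInvariantPairing.injective {B : V →ₗ[ℂ] Dual ℂ W} (hB : IsInvariantPairing ρ τ B)
    (hρ : RepIsIrreducible ρ) (h0 : B ≠ 0) : Function.Injective B := by
  rw [← LinearMap.ker_eq_bot]
  refine (hρ.2 (LinearMap.ker B) fun g x hx => ?_).resolve_right
    fun h => h0 (LinearMap.ker_eq_top.1 h)
  ext y
  rw [hB.apply_left, LinearMap.mem_ker.1 hx]
  rfl

theorem IsInvariantPairing.bijective [FiniteDimensional ℂ V] [FiniteDimensional ℂ W]
    {B : V →ₗ[ℂ] Dual ℂ W} (hB : IsInvariantPairing ρ τ B)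
    (hρ : RepIsIrreducible ρ) (hτ : RepIsIrreducible τ) (h0 : B ≠ 0) :
    Function.Bijective B := by
  have h1 := hB.injective hρ h0
  have h2 := hB.flip.injective hτ fun h => h0 (by rw [← LinearMap.flip_flip B, h]; rfl)
  have d1 := LinearMap.finrank_le_finrank_of_injective h1
  have d2 := LinearMap.finrank_le_finrank_of_injective h2
  rw [Subspace.dual_finrank_eq] at d1 d2
  refine ⟨h1, (LinearMap.injective_iff_surjective_of_finrank_eq_finrank ?_).1 h1⟩
  rw [Subspace.dual_finrank_eq]
  exact le_antisymm d1 d2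

/-- Schur's lemma for pairings: invariant forms are proportional to a non-degenerate one. -/
theorem IsInvariantPairing.exists_eq_smul [FiniteDimensional ℂ V] {B : V →ₗ[ℂ] Dual ℂ W}
    (hB : IsInvariantPairing ρ τ B) (hρ : RepIsIrreducible ρ) {e : V ≃ₗ[ℂ] Dual ℂ W}
    (he : IsInvariantPairing ρ τ e.toLinearMap) : ∃ c : ℂ, ∀ x y, B x y = c * e x y := by
  have := hρ.1
  obtain ⟨c, hc⟩ := Module.End.exists_eigenvalue (e.symm.toLinearMap ∘ₗ B)
  have mem (x : V) : x ∈ Module.End.eigenspace (e.symm.toLinearMap ∘ₗ B) c ↔ B x = c • e x := by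
    rw [Module.End.mem_eigenspace_iff, ← e.map_smul, ← LinearEquiv.symm_apply_eq]
    rfl
  have htop := (hρ.2 (Module.End.eigenspace (e.symm.toLinearMap ∘ₗ B) c) fun g x hx => by
    rw [mem] at hx ⊢
    ext y
    have h2 := he.apply_left g x y
    rw [LinearEquiv.coe_coe] at h2
    rw [hB.apply_left, hx, LinearMap.smul_apply, LinearMap.smul_apply, h2]).resolve_left hc
  refine ⟨c, fun x y => ?_⟩
  rw [(mem x).1 (htop ▸ Submodule.mem_top)]
  rfl

/-- An invariant pairing of a finite group is determined on invariants by its values against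
invariants. -/
theorem IsInvariantPairing.eq_zero_of_forall_invariants [Fintype G] {B : V →ₗ[ℂ] Dual ℂ W}
    (hB : IsInvariantPairing ρ τ B) {x : V} (hx : x ∈ ρ.invariants)
    (h : ∀ y ∈ τ.invariants, B x y = 0) (y : W) : B x y = 0 := by
  have hinv : ∑ g : G, τ g y ∈ τ.invariants := fun k => by
    rw [map_sum]
    refine Fintype.sum_equiv (Equiv.mulLeft k) _ _ fun g => ?_
    simp
  have hsum := h _ hinv
  have hterm (g : G) : B x (τ g y) = B x y := by
    conv_lhs => rw [← hx g]
    exact hB g x y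
  simpa [hterm] using hsum

end Pairing

section FrobeniusSchur

variable {G V : Type*} [Group G] [Fintype G] [AddCommGroup V] [Module ℂ V]
  {ρ : Representation ℂ G V}

/-- The average of a bilinear form over a finite group. -/
def averagePairing (ρ : Representation ℂ G V) (B : V →ₗ[ℂ] Dual ℂ V) : V →ₗ[ℂ] Dual ℂ V :=
  (Fintype.card G : ℂ)⁻¹ • ∑ g : G, (ρ g).dualMap ∘ₗ B ∘ₗ ρ g

theorem averagePairing_apply (B : V →ₗ[ℂ] Dual ℂ V) (x y : V) :
    averagePairing ρ B x y = (Fintype.card G : ℂ)⁻¹ * ∑ g : G, B (ρ g x) (ρ g y) := by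
  simp [averagePairing, LinearMap.sum_apply]

theorem isInvariantPairing_averagePairing (B : V →ₗ[ℂ] Dual ℂ V) :
    IsInvariantPairing ρ ρ (averagePairing ρ B) := by
  intro g x y
  rw [averagePairing_apply, averagePairing_apply]
  congr 1
  refine Fintype.sum_equiv (Equiv.mulRight g) _ _ fun h => ?_
  simp

theorem fsIndicator_eq_sum {ι : Type*} [Fintype ι] (b : Basis ι ℂ V) :
    fsIndicator G ρ = ∑ i, ∑ j,
      averagePairing ρ ((b.coord i).smulRight (b.coord j)) (b j) (b i) := by
  classical
  have h (g : G) : LinearMap.trace ℂ V (ρ (g * g)) =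
      ∑ i, ∑ j, b.repr (ρ g (b j)) i * b.repr (ρ g (b i)) j := by
    rw [map_mul, LinearMap.trace_eq_matrix_trace ℂ b, LinearMap.toMatrix_mul, Matrix.trace]
    simp [Matrix.mul_apply, LinearMap.toMatrix_apply]
  simp only [averagePairing_apply, fsIndicator, h, ← Finset.mul_sum]
  congr 1
  rw [Finset.sum_comm]
  refine Finset.sum_congr rfl fun i _ => ?_
  rw [Finset.sum_comm]
  simp

theorem fsIndicator_eq_zero [FiniteDimensional ℂ V] (hρ : RepIsIrreducible ρ)
    (h : ¬ IsDuallyPaired ρ ρ) : fsIndicator G ρ = 0 := by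
  rw [fsIndicator_eq_sum (Module.finBasis ℂ V)]
  refine Finset.sum_eq_zero fun i _ => Finset.sum_eq_zero fun j _ => ?_
  by_contra h0
  have hinv := isInvariantPairing_averagePairing (ρ := ρ)
    (((Module.finBasis ℂ V).coord i).smulRight ((Module.finBasis ℂ V).coord j))
  refine h ⟨LinearEquiv.ofBijective _ (hinv.bijective hρ hρ fun h1 => h0 ?_), hinv⟩
  rw [h1]
  rfl

theorem fsIndicator_of_pairing [FiniteDimensional ℂ V] (hρ : RepIsIrreducible ρ)
    {e : V ≃ₗ[ℂ] Dual ℂ V} (he : IsInvariantPairing ρ ρ e.toLinearMap) :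
    fsIndicator G ρ ^ 2 = 1 ∧ ∀ x y, e x y = fsIndicator G ρ * e y x := by
  have := hρ.1
  obtain ⟨x₀, hx₀⟩ := exists_ne (0 : V)
  obtain ⟨y₀, hy₀⟩ : ∃ y, e x₀ y ≠ 0 := by
    by_contra! h
    exact hx₀ (e.map_eq_zero_iff.1 (LinearMap.ext h))
  obtain ⟨c, hc⟩ := he.flip.exists_eq_smul hρ he
  replace hc (x y : V) : e y x = c * e x y := hc x y
  have hc2 : c ^ 2 = 1 := by
    apply mul_right_cancel₀ hy₀
    rw [one_mul, sq, mul_assoc, ← hc, ← hc]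
  let b := Module.finBasis ℂ V
  choose a ha using fun i j => (isInvariantPairing_averagePairing (ρ := ρ)
    ((b.coord i).smulRight (b.coord j))).exists_eq_smul hρ he
  have hsum : ∑ i, ∑ j, a i j * e (b i) (b j) = 1 := by
    apply mul_right_cancel₀ hy₀
    have hexp (x y : V) : e x y = ∑ i, ∑ j, e (b i) (b j) * (b.repr x i * b.repr y j) := by
      conv_lhs => rw [← b.sum_repr x, ← b.sum_repr y]
      simp only [map_sum, map_smul, LinearMap.sum_apply, LinearMap.smul_apply, smul_eq_mul,
        Finset.mul_sum]
      rw [Finset.sum_comm]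
      refine Finset.sum_congr rfl fun i _ => Finset.sum_congr rfl fun j _ => by ring
    have havg : e x₀ y₀ = (Fintype.card G : ℂ)⁻¹ * ∑ g : G, e (ρ g x₀) (ρ g y₀) := by
      have h (g : G) : e (ρ g x₀) (ρ g y₀) = e x₀ y₀ := he g x₀ y₀
      simp [h]
    calc (∑ i, ∑ j, a i j * e (b i) (b j)) * e x₀ y₀
        = ∑ i, ∑ j, e (b i) (b j) * (a i j * e x₀ y₀) := by
          simp only [Finset.sum_mul]
          exact Finset.sum_congr rfl fun i _ => Finset.sum_congr rfl fun j _ => by ring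
      _ = ∑ i, ∑ j, ∑ g : G, (Fintype.card G : ℂ)⁻¹ *
            (e (b i) (b j) * (b.repr (ρ g x₀) i * b.repr (ρ g y₀) j)) := by
          refine Finset.sum_congr rfl fun i _ => Finset.sum_congr rfl fun j _ => ?_
          rw [← ha, averagePairing_apply, mul_left_comm, Finset.mul_sum, Finset.mul_sum]
          simp
      _ = ∑ i, ∑ g : G, ∑ j, (Fintype.card G : ℂ)⁻¹ *
            (e (b i) (b j) * (b.repr (ρ g x₀) i * b.repr (ρ g y₀) j)) :=
          Finset.sum_congr rfl fun i _ => Finset.sum_comm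
      _ = (Fintype.card G : ℂ)⁻¹ * ∑ g : G, e (ρ g x₀) (ρ g y₀) := by
          rw [Finset.sum_comm]
          simp only [hexp (ρ _ x₀), Finset.mul_sum]
      _ = 1 * e x₀ y₀ := by rw [one_mul, ← havg]
  have hfs : fsIndicator G ρ = c := by
    rw [fsIndicator_eq_sum b]
    simp only [ha]
    calc _ = ∑ i, ∑ j, c * (a i j * e (b i) (b j)) := by
          refine Finset.sum_congr rfl fun i _ => Finset.sum_congr rfl fun j _ => ?_
          rw [hc (b i) (b j)]
          ring
      _ = c := by simp only [← Finset.mul_sum, hsum, mul_one]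
  rw [hfs]
  exact ⟨hc2, fun x y => hc y x⟩

end FrobeniusSchur

/-- A symmetric relation `D` satisfying a three-step transitivity law and hit by a permutation
is hit by an involution fixing every `D`-reflexive point. -/
theorem exists_involutive_of_perm {α : Type*} [Fintype α] [LinearOrder α] {D : α → α → Prop}
    (hsymm : ∀ i j, D i j → D j i) (htrans : ∀ i j k l, D i j → D j k → D k l → D i l)
    (π : Equiv.Perm α) (hπ : ∀ i, D (π i) i) :
    ∃ σ : α → α, Function.Involutive σ ∧ (∀ i, D (σ i) i) ∧ ∀ i, D i i → σ i = i := by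
  classical
  -- The equivalence class of `i`, its dual class, and the position of `i` in its class.
  let C (i : α) : Finset α := {j | D (π i) j}
  let C' (i : α) : Finset α := {j | D i j}
  let r (i : α) : ℕ := ((C i).filter (· < i)).card
  have hself (i : α) : i ∈ C i := by simpa [C] using hπ i
  have hCC (i j : α) (h : D i j) : C j = C' i := by
    ext k
    simp only [C, C', Finset.mem_filter, Finset.mem_univ, true_and]
    exact ⟨fun hk => htrans _ _ _ _ h (hsymm _ _ (hπ j)) hk,
      fun hk => htrans _ _ _ _ (hπ j) (hsymm _ _ h) hk⟩
  have hcard (i : α) : (C' i).card = (C i).card := by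
    symm
    refine Finset.card_bij (fun j _ => π j) (fun j hj => ?_) (fun _ _ _ _ h => π.injective h)
      fun k hk => ⟨π.symm k, ?_, by simp⟩
    · simp only [C, C', Finset.mem_filter, Finset.mem_univ, true_and] at hj ⊢
      exact htrans _ _ _ _ (hsymm _ _ (hπ i)) hj (hsymm _ _ (hπ j))
    · simp only [C, C', Finset.mem_filter, Finset.mem_univ, true_and] at hk ⊢
      have := hπ (π.symm k)
      rw [Equiv.apply_symm_apply] at this
      exact htrans _ _ _ _ (hπ i) hk this
  have hlt (i : α) : r i < (C i).card :=
    Finset.card_lt_card (Finset.filter_ssubset.2 ⟨i, hself i, lt_irrefl i⟩)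
  have hmono {i j k : α} (hj : D i j) (hk : D i k) (h : j < k) : r j < r k := by
    refine Finset.card_lt_card (Finset.ssubset_iff_subset_ne.2 ⟨fun l hl => ?_, fun heq => ?_⟩)
    · rw [Finset.mem_filter, hCC i j hj] at hl
      rw [Finset.mem_filter, hCC i k hk]
      exact ⟨hl.1, hl.2.trans h⟩
    · have : j ∈ (C k).filter (· < k) := by
        rw [Finset.mem_filter, hCC i k hk, ← hCC i j hj]
        exact ⟨hself j, h⟩
      rw [← heq, Finset.mem_filter] at this
      exact lt_irrefl _ this.2
  have huniq {i j k : α} (hj : D i j) (hk : D i k) (h : r j = r k) : j = k := by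
    rcases lt_trichotomy j k with h' | h' | h'
    · exact absurd h (hmono hj hk h').ne
    · exact h'
    · exact absurd h (hmono hk hj h').ne'
  have hex (i : α) : ∃ j, D i j ∧ r j = r i := by
    have hinj : Set.InjOn r (C' i) := fun j hj k hk h =>
      huniq (by simpa [C'] using hj) (by simpa [C'] using hk) h
    have himg : (C' i).image r = Finset.range (C i).card := by
      refine Finset.eq_of_subset_of_card_le (fun n hn => ?_) ?_
      · obtain ⟨j, hj, rfl⟩ := Finset.mem_image.1 hn
        rw [Finset.mem_range, ← hcard, ← hCC i j (by simpa [C'] using hj)]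
        exact hlt j
      · rw [Finset.card_image_of_injOn hinj, Finset.card_range, hcard i]
    obtain ⟨j, hj, hr⟩ := Finset.mem_image.1 (himg ▸ Finset.mem_range.2 (hlt i))
    exact ⟨j, by simpa [C'] using hj, hr⟩
  choose σ hσ hr using hex
  exact ⟨σ, fun i => huniq (hσ (σ i)) (hsymm _ _ (hσ i)) ((hr _).trans (hr i)),
    fun i => hsymm _ _ (hσ i), fun i hi => huniq (hσ i) hi (hr i)⟩

/-- A space with a non-degenerate antisymmetric form is even-dimensional. -/
theorem even_finrank_of_antisymm {H : Type*} [AddCommGroup H] [Module ℂ H]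
    [FiniteDimensional ℂ H] (β : H →ₗ[ℂ] H →ₗ[ℂ] ℂ) (hβ : ∀ v, (∀ w, β v w = 0) → v = 0)
    (hanti : ∀ v w, β w v = -β v w) : Even (Module.finrank ℂ H) := by
  let b := Module.finBasis ℂ H
  let M := LinearMap.toMatrix₂ b b β
  have hT : M.transpose = -M := by
    ext i j
    simp [M, LinearMap.toMatrix₂_apply, hanti (b i) (b j)]
  have hdet : M.det ≠ 0 := by
    refine (LinearMap.separatingLeft_iff_det_ne_zero b).1 ?_
    exact hβ
  by_contra hodd
  rw [Nat.not_even_iff_odd] at hodd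
  have h := congrArg Matrix.det hT
  rw [Matrix.det_transpose, Matrix.det_neg, Fintype.card_fin, hodd.neg_one_pow] at h
  exact hdet (by linear_combination h / 2)

section Tensor

variable {ℓ : ℕ} {G : Type*} [Group G] {V : Fin ℓ → Type*} [∀ i, AddCommGroup (V i)]
  [∀ i, Module ℂ (V i)]

/-- Coherent choice of pairings: `b i j` and `b j i` are flips of each other for `i ≠ j`. -/
theorem exists_pairing_family [∀ i, FiniteDimensional ℂ (V i)]
    (ρ : ∀ i, Representation ℂ G (V i)) :
    ∃ b : ∀ i j, V i →ₗ[ℂ] Dual ℂ (V j), (∀ i j, IsDuallyPaired (ρ i) (ρ j) →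
      Function.Bijective (b i j) ∧ IsInvariantPairing (ρ i) (ρ j) (b i j)) ∧
      ∀ i j, i ≠ j → b i j = (b j i).flip := by
  classical
  let c (i j : Fin ℓ) : V i →ₗ[ℂ] Dual ℂ (V j) :=
    if h : IsDuallyPaired (ρ i) (ρ j) then h.choose.toLinearMap else 0
  have hc (i j) (h : IsDuallyPaired (ρ i) (ρ j)) :
      Function.Bijective (c i j) ∧ IsInvariantPairing (ρ i) (ρ j) (c i j) := by
    simp only [c, dif_pos h]
    exact ⟨h.choose.bijective, h.choose_spec⟩
  refine ⟨fun i j => if i ≤ j then c i j else (c j i).flip, fun i j h => ?_, fun i j h => ?_⟩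
  · dsimp only
    split_ifs
    · exact hc i j h
    · exact ⟨flip_bijective (hc j i h.symm).1, (hc j i h.symm).2.flip⟩
  · dsimp only
    rcases lt_or_gt_of_ne h with h | h
    · rw [if_pos h.le, if_neg h.not_ge, LinearMap.flip_flip]
    · rw [if_neg h.not_ge, if_pos h.le]

theorem piTensorRep_tprod (ρ : ∀ i, Representation ℂ G (V i)) (g : G) (v : ∀ i, V i) :
    piTensorRep ρ g (⨂ₜ[ℂ] i, v i) = ⨂ₜ[ℂ] i, ρ i g (v i) :=
  PiTensorProduct.map_tprod _ _

/-- Pairings of `V (σ i)` with `V i` induce a pairing of the tensor product with itself. -/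
def tensorPairing [∀ i, FiniteDimensional ℂ (V i)] (σ : Equiv.Perm (Fin ℓ))
    (e : ∀ i, V (σ.symm i) ≃ₗ[ℂ] Dual ℂ (V i)) : (⨂[ℂ] i, V i) ≃ₗ[ℂ] Dual ℂ (⨂[ℂ] i, V i) :=
  (PiTensorProduct.reindex ℂ V σ).trans
    ((PiTensorProduct.congr e).trans PiTensorProduct.dualDistribEquiv)

theorem tensorPairing_tprod [∀ i, FiniteDimensional ℂ (V i)] (σ : Equiv.Perm (Fin ℓ))
    (e : ∀ i, V (σ.symm i) ≃ₗ[ℂ] Dual ℂ (V i)) (v w : ∀ i, V i) :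
    tensorPairing σ e (⨂ₜ[ℂ] i, v i) (⨂ₜ[ℂ] i, w i) = ∏ i, e i (v (σ.symm i)) (w i) := by
  simp only [tensorPairing, LinearEquiv.trans_apply, PiTensorProduct.reindex_tprod,
    PiTensorProduct.congr_tprod]
  exact PiTensorProduct.dualDistrib_apply _ _

theorem pairing_ext {E : Type*} [AddCommGroup E] [Module ℂ E]
    {A B : (⨂[ℂ] i, V i) →ₗ[ℂ] (⨂[ℂ] i, V i) →ₗ[ℂ] E}
    (h : ∀ v w : ∀ i, V i, A (⨂ₜ[ℂ] i, v i) (⨂ₜ[ℂ] i, w i) = B (⨂ₜ[ℂ] i, v i) (⨂ₜ[ℂ] i, w i)) : A = B :=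
  PiTensorProduct.ext (MultilinearMap.ext fun v =>
    PiTensorProduct.ext (MultilinearMap.ext fun w => h v w))

/-- The tensor product carries a non-degenerate invariant form of the predicted symmetry. -/
theorem exists_invariant_form [Fintype G] [∀ i, FiniteDimensional ℂ (V i)]
    (ρ : ∀ i, Representation ℂ G (V i)) (hirr : ∀ i, RepIsIrreducible (ρ i))
    (π : Equiv.Perm (Fin ℓ)) (hπ : ∀ i, IsDuallyPaired (ρ (π i)) (ρ i)) :
    ∃ B : (⨂[ℂ] i, V i) ≃ₗ[ℂ] Dual ℂ (⨂[ℂ] i, V i),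
      IsInvariantPairing (piTensorRep ρ) (piTensorRep ρ) B.toLinearMap ∧
      ∀ v w, B w v = (∏ i, (1 + fsIndicator G (ρ i) - fsIndicator G (ρ i) ^ 2)) * B v w := by
  obtain ⟨σ, hσ, hσD, hfix⟩ := exists_involutive_of_perm
    (D := fun i j => IsDuallyPaired (ρ i) (ρ j)) (fun _ _ h => h.symm)
    (fun _ _ _ _ h₁ h₂ h₃ => h₁.trans_trans h₂ h₃) π hπ
  obtain ⟨b, hb, hflip⟩ := exists_pairing_family ρ
  have hsign (i j : Fin ℓ) (h : σ i = j) (x : V i) (y : V j) :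
      b j i y x = (1 + fsIndicator G (ρ i) - fsIndicator G (ρ i) ^ 2) * b i j x y := by
    by_cases hii : IsDuallyPaired (ρ i) (ρ i)
    · obtain rfl : i = j := (hfix i hii).symm.trans h
      obtain ⟨hsq, hsymm⟩ := fsIndicator_of_pairing (hirr i)
        (e := LinearEquiv.ofBijective _ (hb i i hii).1) (hb i i hii).2
      rw [hsq, add_sub_cancel_left]
      exact hsymm y x
    · have hij : j ≠ i := by
        rintro rfl
        have := hσD j
        rw [h] at this
        exact hii this
      rw [fsIndicator_eq_zero (hirr i) hii, hflip j i hij]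
      simp
  let e (i : Fin ℓ) : V ((hσ.toPerm).symm i) ≃ₗ[ℂ] Dual ℂ (V i) :=
    LinearEquiv.ofBijective (b (σ i) i) (hb _ _ (hσD i)).1
  have he (v w : ∀ i, V i) : tensorPairing hσ.toPerm e (⨂ₜ[ℂ] i, v i) (⨂ₜ[ℂ] i, w i) =
      ∏ i, b (σ i) i (v (σ i)) (w i) := tensorPairing_tprod _ _ _ _
  refine ⟨tensorPairing hσ.toPerm e, fun g => ?_, ?_⟩
  · suffices h : (tensorPairing hσ.toPerm e).toLinearMap.compl₁₂ (piTensorRep ρ g)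
        (piTensorRep ρ g) = (tensorPairing hσ.toPerm e).toLinearMap from
      fun x y => LinearMap.congr_fun₂ h x y
    refine pairing_ext fun v w => ?_
    simp only [LinearMap.compl₁₂_apply, piTensorRep_tprod, LinearEquiv.coe_coe, he]
    exact Finset.prod_congr rfl fun i _ => (hb _ _ (hσD i)).2 g _ _
  · suffices h : (tensorPairing hσ.toPerm e).toLinearMap.flip =
        (∏ i, (1 + fsIndicator G (ρ i) - fsIndicator G (ρ i) ^ 2)) •
          (tensorPairing hσ.toPerm e).toLinearMap from
      fun x y => LinearMap.congr_fun₂ h x y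
    refine pairing_ext fun v w => ?_
    simp only [LinearMap.flip_apply, LinearMap.smul_apply, smul_eq_mul, LinearEquiv.coe_coe, he]
    rw [Finset.prod_congr rfl fun i _ => hsign i (σ i) rfl (v i) (w (σ i)),
      Finset.prod_mul_distrib]
    congr 1
    rw [← Equiv.prod_comp hσ.toPerm fun i => b i (σ i) (v i) (w (σ i))]
    refine Finset.prod_congr rfl fun i _ => ?_
    change b (σ i) (σ (σ i)) (v (σ i)) (w (σ (σ i))) = _
    rw [hσ i]

end Tensor

end Auxiliary

/-- Let `V₁, …, V_ℓ` be irreducible finite-dimensional complex representations of a finite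
group `G` with Frobenius–Schur indicators `ν_i`, and suppose some permutation `π` satisfies
`V_{π(i)} ≅ V_i*` for all `i`.  Set `ν := ∏ i (1 + ν_i - ν_i²)`.  Then the space of
`G`-invariants `H` of `V₁ ⊗ ⋯ ⊗ V_ℓ` carries a non-degenerate bilinear form which is
symmetric if `ν = 1` and antisymmetric if `ν = -1`; in particular if `ν = -1` then `H` is
even-dimensional. -/
theorem exists_nondegenerate_pairing_on_invariants_of_perm
    {ℓ : ℕ} {G : Type*} [Group G] [Fintype G]
    (V : Fin ℓ → Type*) [∀ i, AddCommGroup (V i)] [∀ i, Module ℂ (V i)]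
    [∀ i, FiniteDimensional ℂ (V i)]
    (ρ : ∀ i, Representation ℂ G (V i))
    (hirr : ∀ i, RepIsIrreducible (ρ i))
    (hπ : ∃ π : Equiv.Perm (Fin ℓ), ∀ i,
      ∃ e : V (π i) ≃ₗ[ℂ] Module.Dual ℂ (V i),
        ∀ (g : G) (v : V (π i)), e (ρ (π i) g v) = (ρ i).dual g (e v)) :
    ∃ β : (piTensorRep ρ).invariants →ₗ[ℂ] (piTensorRep ρ).invariants →ₗ[ℂ] ℂ,
      (∀ v, (∀ w, β v w = 0) → v = 0) ∧
      (∀ w, (∀ v, β v w = 0) → w = 0) ∧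
      ((∏ i, (1 + fsIndicator G (ρ i) - (fsIndicator G (ρ i)) ^ 2)) = 1 →
        ∀ v w, β w v = β v w) ∧
      ((∏ i, (1 + fsIndicator G (ρ i) - (fsIndicator G (ρ i)) ^ 2)) = -1 →
        (∀ v w, β w v = -β v w) ∧
          Even (Module.finrank ℂ (piTensorRep ρ).invariants)) := by
  obtain ⟨π, hπ⟩ := hπ
  obtain ⟨B, hB, hsymm⟩ := exists_invariant_form ρ hirr π fun i => by
    obtain ⟨e, he⟩ := hπ i
    refine ⟨e, fun g x y => ?_⟩
    rw [LinearEquiv.coe_coe, he, Representation.dual_apply]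
    simp [Module.Dual.transpose_apply]
  have hleft (v : (piTensorRep ρ).invariants)
      (h : ∀ w : (piTensorRep ρ).invariants, B v w = 0) : v = 0 :=
    Subtype.ext (B.map_eq_zero_iff.1
      (LinearMap.ext fun x => hB.eq_zero_of_forall_invariants v.2 (fun w hw => h ⟨w, hw⟩) x))
  have hright (w : (piTensorRep ρ).invariants)
      (h : ∀ v : (piTensorRep ρ).invariants, B v w = 0) : w = 0 :=
    hleft w fun v => by rw [hsymm, h, mul_zero]
  refine ⟨B.toLinearMap.domRestrict₁₂ _ _, hleft, hright, fun h v w => ?_, fun h => ?_⟩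
  · exact (hsymm v w).trans (by rw [h, one_mul]; rfl)
  · have hanti (v w : (piTensorRep ρ).invariants) : B w v = -B v w := by
      rw [hsymm, h, neg_one_mul]
    exact ⟨hanti, even_finrank_of_antisymm (B.toLinearMap.domRestrict₁₂ _ _) hleft hanti⟩

end
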